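/- Let K ≥ 1, α ∈ (0,1), and a₁, …, a_K > 0. Let S₁, …, S_K be independent real random variables with S_k Gamma(2,a_k)-distributed, let Y be uniformly distributed on [1-α², 1], and let J be uniformly distributed on {1, …, K}, with (S₁,…,S_K), Y, and J mutually independent. Then E[log(1 + S_J·Y)] = (1/K)·∑_{k=1}^{K} [ ((1-α²)/α²)·G(a_k/(1-α²)) - (1/α²)·G(a_k) ]. (This is the ergodic per-user rate of the Random User Selection scheme in multi-user mode with zero-forcing beamforming, with a_k = σ²/g_k.) -/

import Mathlib

open MeasureTheory Real Set
open scoped ENNReal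

/-- The Gamma(2, a) law: density `a² · x · e^{-a·x}` on `(0, ∞)` (shape 2, rate `a`). -/
noncomputable def gammaLaw (a : ℝ) : Measure ℝ :=
  volume.withDensity fun x =>
    ENNReal.ofReal (if 0 < x then a ^ 2 * x * Real.exp (-(a * x)) else 0)

/-- The uniform law on the real interval `[lo, hi]`. -/
noncomputable def unifLaw (lo hi : ℝ) : Measure ℝ :=
  (ENNReal.ofReal (hi - lo))⁻¹ • volume.restrict (Set.Icc lo hi)

/-- The uniform law on a finite type (here `Fin K`). -/
noncomputable def unifFin (K : ℕ) : Measure (Fin K) := (K : ℝ≥0∞)⁻¹ • Measure.count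

/-- `G(x) = e^x·Ei(-x) = -e^x·∫_x^∞ (e^{-t}/t) dt` for `x > 0`. -/
noncomputable def Gfun (x : ℝ) : ℝ := -(Real.exp x * ∫ t in Set.Ioi x, Real.exp (-t) / t)

/-- The antiderivative of `u ↦ log (1 + u)` vanishing at `0`. -/
noncomputable def logPrimitive (u : ℝ) : ℝ := (1 + u) * Real.log (1 + u) - u

lemma hasDerivAt_logPrimitive {u : ℝ} (hu : 0 ≤ u) :
    HasDerivAt logPrimitive (Real.log (1 + u)) u := by
  have h1 : HasDerivAt (fun u : ℝ => 1 + u) 1 u := (hasDerivAt_id u).const_add 1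
  have h2 := (h1.mul (h1.log (by positivity))).sub (hasDerivAt_id u)
  convert! h2 using 1
  have : (1 + u) ≠ 0 := by positivity
  field_simp
  ring

lemma log_one_add_le {u : ℝ} (hu : 0 ≤ u) : Real.log (1 + u) ≤ u := by
  linarith [Real.log_le_sub_one_of_pos (show 0 < 1 + u by positivity)]

lemma logPrimitive_nonneg {u : ℝ} (hu : 0 ≤ u) : 0 ≤ logPrimitive u := by
  have h := Real.one_sub_inv_le_log_of_pos (show 0 < 1 + u by positivity)
  have h2 := mul_le_mul_of_nonneg_left h (show 0 ≤ 1 + u by positivity)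
  have h3 : (1 + u) * (1 - (1 + u)⁻¹) = u := by
    field_simp
    ring
  unfold logPrimitive
  linarith

lemma logPrimitive_le_sq {u : ℝ} (hu : 0 ≤ u) : logPrimitive u ≤ u ^ 2 := by
  have h := mul_le_mul_of_nonneg_left (log_one_add_le hu) (show 0 ≤ 1 + u by positivity)
  unfold logPrimitive
  linarith

lemma measurable_logPrimitive : Measurable logPrimitive := by
  unfold logPrimitive
  fun_prop

lemma integrableOn_pow_mul_exp_neg_mul_Ioi (n : ℕ) {a : ℝ} (ha : 0 < a) :
    IntegrableOn (fun s : ℝ => s ^ n * Real.exp (-(a * s))) (Ioi 0) := by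
  have h := integrableOn_rpow_mul_exp_neg_mul_rpow (p := 1) (s := n) (b := a)
    (by have : (0 : ℝ) ≤ n := n.cast_nonneg
        linarith) one_pos ha
  refine h.congr_fun (fun s _ => ?_) measurableSet_Ioi
  simp

lemma integrableOn_exp_neg_mul_mul_logPrimitive {a y : ℝ} (ha : 0 < a) (hy : 0 < y) :
    IntegrableOn (fun s : ℝ => a ^ 2 * Real.exp (-(a * s)) * logPrimitive (y * s)) (Ioi 0) := by
  have h := (integrableOn_pow_mul_exp_neg_mul_Ioi 2 ha).const_mul (a ^ 2 * y ^ 2)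
  refine h.mono' ?_ ?_
  · have := measurable_logPrimitive
    exact Measurable.aestronglyMeasurable (by fun_prop)
  · refine (ae_restrict_iff' measurableSet_Ioi).2 (ae_of_all _ fun s (hs : 0 < s) => ?_)
    have h0 := logPrimitive_nonneg (mul_pos hy hs).le
    rw [Real.norm_of_nonneg (by positivity)]
    have := mul_le_mul_of_nonneg_left (logPrimitive_le_sq (mul_pos hy hs).le)
      (show 0 ≤ a ^ 2 * Real.exp (-(a * s)) by positivity)
    linarith

lemma integrableOn_exp_neg_mul_div {a y : ℝ} (ha : 0 < a) (hy : 0 < y) :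
    IntegrableOn (fun s : ℝ => y ^ 2 * Real.exp (-(a * s)) / (1 + y * s)) (Ioi 0) := by
  have h := (integrableOn_pow_mul_exp_neg_mul_Ioi 0 ha).const_mul (y ^ 2)
  refine h.mono' (Measurable.aestronglyMeasurable (by fun_prop)) ?_
  refine (ae_restrict_iff' measurableSet_Ioi).2 (ae_of_all _ fun s (hs : 0 < s) => ?_)
  have := mul_pos hy hs
  rw [Real.norm_of_nonneg (by positivity), pow_zero, one_mul]
  exact div_le_self (by positivity) (by linarith)

lemma integral_exp_neg_mul_div {a y : ℝ} (ha : 0 < a) (hy : 0 < y) :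
    ∫ s in Ioi (0 : ℝ), y ^ 2 * Real.exp (-(a * s)) / (1 + y * s) = -(y * Gfun (a / y)) := by
  have hscale := integral_comp_mul_left_Ioi
    (fun t : ℝ => Real.exp (-(t + a / y)) / (t + a / y)) 0 ha
  have hshift := (measurePreserving_add_right volume (a / y)).setIntegral_preimage_emb
    (measurableEmbedding_addRight (a / y)) (fun t : ℝ => Real.exp (-t) / t) (Ioi (a / y))
  have hpre : (fun t : ℝ => t + a / y) ⁻¹' Ioi (a / y) = Ioi 0 := by
    ext t
    simp
  rw [hpre] at hshift
  rw [mul_zero, hshift] at hscale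
  have hI : ∀ s ∈ Ioi (0 : ℝ), y ^ 2 * Real.exp (-(a * s)) / (1 + y * s)
      = (y * a * Real.exp (a / y)) * (Real.exp (-(a * s + a / y)) / (a * s + a / y)) := by
    intro s (hs : 0 < s)
    rw [neg_add, Real.exp_add, Real.exp_neg (a / y)]
    have h1 : 1 + y * s ≠ 0 := by positivity
    have h2 : a * s + a / y ≠ 0 := by positivity
    have h3 : a * s + a / y = a * (1 + y * s) / y := by
      field_simp
      ring
    rw [h3]
    field_simp
  rw [setIntegral_congr_fun measurableSet_Ioi hI, integral_const_mul, hscale, Gfun, smul_eq_mul]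
  field_simp

/-- Minus the boundary terms produced by integrating by parts twice. -/
lemma hasDerivAt_exp_neg_mul_logPrimitive (a : ℝ) {y s : ℝ} (hy : 0 < y) (hs : 0 ≤ s) :
    HasDerivAt (fun s : ℝ => -(Real.exp (-(a * s)) *
        (a * logPrimitive (y * s) + y * Real.log (1 + y * s))))
      (a ^ 2 * Real.exp (-(a * s)) * logPrimitive (y * s)
        - y ^ 2 * Real.exp (-(a * s)) / (1 + y * s)) s := by
  have hys : 0 ≤ y * s := by positivity
  have h0 : HasDerivAt (fun s : ℝ => y * s) y s := by
    simpa using (hasDerivAt_id s).const_mul y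
  have h1 : HasDerivAt (fun s : ℝ => Real.exp (-(a * s))) (Real.exp (-(a * s)) * -a) s := by
    simpa using ((hasDerivAt_id s).const_mul a).neg.exp
  have h2 : HasDerivAt (fun s : ℝ => logPrimitive (y * s)) (Real.log (1 + y * s) * y) s :=
    (hasDerivAt_logPrimitive hys).comp s h0
  have h3 := (h0.const_add 1).log (by positivity)
  refine (h1.mul ((h2.const_mul a).add (h3.const_mul y))).neg.congr_deriv ?_
  have : 1 + y * s ≠ 0 := by positivity
  simp only [Pi.add_apply]
  field_simp
  ring

lemma tendsto_exp_neg_mul_logPrimitive {a y : ℝ} (ha : 0 < a) (hy : 0 < y) :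
    Filter.Tendsto (fun s : ℝ => -(Real.exp (-(a * s)) *
        (a * logPrimitive (y * s) + y * Real.log (1 + y * s)))) Filter.atTop (nhds 0) := by
  have h2 := tendsto_rpow_mul_exp_neg_mul_atTop_nhds_zero 2 a ha
  have h1 := tendsto_rpow_mul_exp_neg_mul_atTop_nhds_zero 1 a ha
  have h := (h2.const_mul (a * y ^ 2)).add (h1.const_mul (y ^ 2))
  simp only [mul_zero, add_zero] at h
  refine squeeze_zero_norm' ?_ h
  filter_upwards [Filter.eventually_gt_atTop 0] with s hs
  have hys := mul_pos hy hs
  have h0 := logPrimitive_nonneg hys.le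
  have h4 := logPrimitive_le_sq hys.le
  have h5 := log_one_add_le hys.le
  have h6 : 0 ≤ Real.log (1 + y * s) := Real.log_nonneg (by linarith)
  rw [norm_neg, Real.norm_of_nonneg (by positivity), Real.rpow_one, Real.rpow_two, neg_mul]
  have h7 : a * logPrimitive (y * s) + y * Real.log (1 + y * s)
      ≤ a * (y * s) ^ 2 + y * (y * s) := by gcongr
  have := mul_le_mul_of_nonneg_left h7 (Real.exp_nonneg (-(a * s)))
  linarith

lemma integral_exp_neg_mul_mul_logPrimitive {a y : ℝ} (ha : 0 < a) (hy : 0 < y) :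
    ∫ s in Ioi (0 : ℝ), a ^ 2 * Real.exp (-(a * s)) * logPrimitive (y * s)
      = -(y * Gfun (a / y)) := by
  have h := integral_Ioi_of_hasDerivAt_of_tendsto'
    (fun s hs => hasDerivAt_exp_neg_mul_logPrimitive a hy hs)
    ((integrableOn_exp_neg_mul_mul_logPrimitive ha hy).sub (integrableOn_exp_neg_mul_div ha hy))
    (tendsto_exp_neg_mul_logPrimitive ha hy)
  rw [integral_sub (integrableOn_exp_neg_mul_mul_logPrimitive ha hy)
    (integrableOn_exp_neg_mul_div ha hy), integral_exp_neg_mul_div ha hy] at h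
  simp only [logPrimitive, mul_zero, add_zero, Real.log_one, sub_zero, neg_zero] at h ⊢
  linarith

lemma mul_integral_log_one_add_mul {s lo hi : ℝ} (hs : 0 < s) (hlo : 0 ≤ lo) (hhi : lo ≤ hi) :
    s * ∫ y in Icc lo hi, Real.log (1 + s * y) = logPrimitive (hi * s) - logPrimitive (lo * s) := by
  rw [integral_Icc_eq_integral_Ioc, ← intervalIntegral.integral_of_le hhi,
    ← intervalIntegral.integral_const_mul]
  have hpos : ∀ y ∈ uIcc lo hi, 0 ≤ s * y := fun y hy => by
    rw [uIcc_of_le hhi] at hy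
    exact mul_nonneg hs.le (hlo.trans hy.1)
  rw [intervalIntegral.integral_eq_sub_of_hasDerivAt
    (f := fun y => logPrimitive (s * y)), mul_comm s, mul_comm s]
  · intro y hy
    have h0 : HasDerivAt (fun y : ℝ => s * y) s y := by
      simpa using (hasDerivAt_id y).const_mul s
    exact ((hasDerivAt_logPrimitive (hpos y hy)).comp y h0).congr_deriv (mul_comm _ _)
  · refine ContinuousOn.intervalIntegrable fun y hy => ContinuousAt.continuousWithinAt ?_
    have : 1 + s * y ≠ 0 := by linarith [hpos y hy]
    fun_prop (disch := assumption)

lemma measurable_gammaLaw_density (a : ℝ) : Measurable fun x : ℝ =>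
    ENNReal.ofReal (if 0 < x then a ^ 2 * x * Real.exp (-(a * x)) else 0) :=
  (Measurable.ite measurableSet_Ioi (by fun_prop) measurable_const).ennreal_ofReal

lemma toReal_gammaLaw_density_smul (a : ℝ) (g : ℝ → ℝ) :
    (fun x : ℝ => (ENNReal.ofReal
      (if 0 < x then a ^ 2 * x * Real.exp (-(a * x)) else 0)).toReal • g x)
      = (Ioi (0 : ℝ)).indicator fun x => a ^ 2 * x * Real.exp (-(a * x)) * g x := by
  ext x
  by_cases hx : 0 < x
  · simp only [hx, if_true, mem_Ioi, indicator_of_mem, smul_eq_mul]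
    rw [ENNReal.toReal_ofReal (by positivity)]
  · simp [hx]

lemma integral_gammaLaw (a : ℝ) (g : ℝ → ℝ) :
    ∫ x, g x ∂gammaLaw a = ∫ x in Ioi 0, a ^ 2 * x * Real.exp (-(a * x)) * g x := by
  rw [gammaLaw, integral_withDensity_eq_integral_toReal_smul (measurable_gammaLaw_density a)
    (ae_of_all _ fun _ => ENNReal.ofReal_lt_top), toReal_gammaLaw_density_smul,
    integral_indicator measurableSet_Ioi]

lemma integrable_gammaLaw_iff (a : ℝ) (g : ℝ → ℝ) :
    Integrable g (gammaLaw a) ↔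
      IntegrableOn (fun x => a ^ 2 * x * Real.exp (-(a * x)) * g x) (Ioi 0) := by
  rw [gammaLaw, integrable_withDensity_iff_integrable_smul' (measurable_gammaLaw_density a)
    (ae_of_all _ fun _ => ENNReal.ofReal_lt_top), toReal_gammaLaw_density_smul,
    integrable_indicator_iff measurableSet_Ioi]

lemma ae_pos_gammaLaw (a : ℝ) : ∀ᵐ x ∂gammaLaw a, 0 < x := by
  rw [gammaLaw, ae_withDensity_iff (measurable_gammaLaw_density a)]
  refine ae_of_all _ fun x hx => ?_
  by_contra h
  simp [h] at hx

lemma gammaLaw_eq_gammaMeasure (a : ℝ) : gammaLaw a = ProbabilityTheory.gammaMeasure 2 a := by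
  rw [gammaLaw, ProbabilityTheory.gammaMeasure]
  congr 1
  ext x
  rw [ProbabilityTheory.gammaPDF_eq]
  congr 1
  rcases lt_trichotomy x 0 with hx | rfl | hx
  · simp [hx.not_gt, hx.not_ge]
  · norm_num
  · have : (2 : ℝ) - 1 = 1 := by norm_num
    simp [hx, hx.le, this]

lemma isProbabilityMeasure_gammaLaw {a : ℝ} (ha : 0 < a) : IsProbabilityMeasure (gammaLaw a) := by
  rw [gammaLaw_eq_gammaMeasure]
  exact ProbabilityTheory.isProbabilityMeasure_gammaMeasure two_pos ha

lemma integrable_id_gammaLaw {a : ℝ} (ha : 0 < a) : Integrable (fun x => x) (gammaLaw a) := by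
  rw [integrable_gammaLaw_iff]
  refine ((integrableOn_pow_mul_exp_neg_mul_Ioi 2 ha).const_mul (a ^ 2)).congr
    (ae_of_all _ fun x => ?_)
  ring

lemma isProbabilityMeasure_unifLaw {lo hi : ℝ} (h : lo < hi) :
    IsProbabilityMeasure (unifLaw lo hi) := by
  constructor
  have h0 : ENNReal.ofReal (hi - lo) ≠ 0 := by simpa using h
  simp [unifLaw, ENNReal.inv_mul_cancel h0 ENNReal.ofReal_ne_top]

lemma isProbabilityMeasure_unifFin {K : ℕ} (hK : 1 ≤ K) : IsProbabilityMeasure (unifFin K) := by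
  constructor
  have h0 : (K : ℝ≥0∞) ≠ 0 := by exact_mod_cast (by lia : K ≠ 0)
  simp [unifFin, ENNReal.inv_mul_cancel h0 (ENNReal.natCast_ne_top K)]

lemma ae_mem_Icc_unifLaw (lo hi : ℝ) : ∀ᵐ y ∂unifLaw lo hi, y ∈ Icc lo hi :=
  Measure.ae_smul_measure (ae_restrict_mem measurableSet_Icc) _

lemma integral_unifLaw {lo hi : ℝ} (h : lo < hi) (g : ℝ → ℝ) :
    ∫ y, g y ∂unifLaw lo hi = (hi - lo)⁻¹ * ∫ y in Icc lo hi, g y := by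
  rw [unifLaw, integral_smul_measure, ENNReal.toReal_inv,
    ENNReal.toReal_ofReal (sub_pos.2 h).le, smul_eq_mul]

lemma integrable_id_unifLaw {lo hi : ℝ} (h : lo < hi) :
    Integrable (fun y => y) (unifLaw lo hi) := by
  refine Integrable.smul_measure ?_ (by simpa using h)
  exact continuous_id.continuousOn.integrableOn_Icc

lemma integrable_log_one_add_mul {a lo hi : ℝ} (ha : 0 < a) (hlo : 0 ≤ lo) (h : lo < hi) :
    Integrable (fun z : ℝ × ℝ => Real.log (1 + z.1 * z.2))
      ((gammaLaw a).prod (unifLaw lo hi)) := by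
  have := isProbabilityMeasure_gammaLaw ha
  have := isProbabilityMeasure_unifLaw h
  refine ((integrable_id_gammaLaw ha).mul_prod (integrable_id_unifLaw h)).mono'
    (Measurable.aestronglyMeasurable (by fun_prop)) ?_
  filter_upwards [Measure.quasiMeasurePreserving_fst.ae (ae_pos_gammaLaw a),
    Measure.quasiMeasurePreserving_snd.ae (ae_mem_Icc_unifLaw lo hi)] with z h1 h2
  have hz : 0 ≤ z.1 * z.2 := mul_nonneg h1.le (hlo.trans h2.1)
  rw [Real.norm_of_nonneg (Real.log_nonneg (by linarith))]
  exact log_one_add_le hz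

lemma integral_log_one_add_mul {a lo hi : ℝ} (ha : 0 < a) (hlo : 0 < lo) (h : lo < hi) :
    ∫ z : ℝ × ℝ, Real.log (1 + z.1 * z.2) ∂(gammaLaw a).prod (unifLaw lo hi)
      = (hi - lo)⁻¹ * (lo * Gfun (a / lo) - hi * Gfun (a / hi)) := by
  have := isProbabilityMeasure_gammaLaw ha
  have := isProbabilityMeasure_unifLaw h
  rw [integral_prod _ (integrable_log_one_add_mul ha hlo.le h), integral_gammaLaw]
  have hI : ∀ s ∈ Ioi (0 : ℝ), a ^ 2 * s * Real.exp (-(a * s)) *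
        ∫ y, Real.log (1 + s * y) ∂unifLaw lo hi
      = (hi - lo)⁻¹ * (a ^ 2 * Real.exp (-(a * s)) * logPrimitive (hi * s)
        - a ^ 2 * Real.exp (-(a * s)) * logPrimitive (lo * s)) := by
    intro s hs
    rw [integral_unifLaw h, ← mul_sub, ← mul_integral_log_one_add_mul hs hlo.le h.le]
    ring
  have hhi := hlo.trans h
  rw [setIntegral_congr_fun measurableSet_Ioi hI, integral_const_mul,
    integral_sub (integrableOn_exp_neg_mul_mul_logPrimitive ha hhi)
      (integrableOn_exp_neg_mul_mul_logPrimitive ha hlo),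
    integral_exp_neg_mul_mul_logPrimitive ha hhi, integral_exp_neg_mul_mul_logPrimitive ha hlo]
  ring

lemma integral_indicator_singleton_unifFin {K : ℕ} (k : Fin K) :
    ∫ j, ({k} : Set (Fin K)).indicator (fun _ => (1 : ℝ)) j ∂unifFin K = 1 / (K : ℝ) := by
  rw [integral_indicator_const _ (measurableSet_singleton k)]
  simp [unifFin, Measure.real]

/-- Ergodic per-user rate of the RUS scheme in multi-user mode with
zero-forcing beamforming: `S₁, …, S_K` independent with `S_k ~ Gamma(2, a_k)`,
`Y ~ Uniform[1-α², 1]`, `J` uniform on `{1, …, K}`, all mutually independent (the joint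
law is the product of the marginals). Then
`E[log(1 + S_J·Y)] = (1/K)·∑_k [((1-α²)/α²)·G(a_k/(1-α²)) - (1/α²)·G(a_k)]`. -/
theorem rus_mu_mode_zf_ergodic_rate {Ω : Type*} [MeasurableSpace Ω]
    (μ : Measure Ω) [IsProbabilityMeasure μ]
    (K : ℕ) (hK : 1 ≤ K) (α : ℝ) (hα : α ∈ Set.Ioo (0 : ℝ) 1)
    (a : Fin K → ℝ) (ha : ∀ k, 0 < a k)
    (S : Fin K → Ω → ℝ) (Y : Ω → ℝ) (J : Ω → Fin K)
    (hSmeas : ∀ k, Measurable (S k)) (hYmeas : Measurable Y) (hJmeas : Measurable J)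
    (hlaw : Measure.map
        (fun ω => ((fun k => S k ω, Y ω, J ω) : (Fin K → ℝ) × ℝ × Fin K)) μ
      = (Measure.pi fun k => gammaLaw (a k)).prod
          ((unifLaw (1 - α ^ 2) 1).prod (unifFin K))) :
    ∫ ω, Real.log (1 + S (J ω) ω * Y ω) ∂μ
      = (1 / (K : ℝ)) * ∑ k : Fin K,
          (((1 - α ^ 2) / α ^ 2) * Gfun (a k / (1 - α ^ 2))
            - (1 / α ^ 2) * Gfun (a k)) := by
  have hα0 : 0 < α ^ 2 := pow_pos hα.1 2
  have hα1 : α ^ 2 < 1 := pow_lt_one₀ hα.1.le hα.2 two_ne_zero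
  have hlo : 0 < 1 - α ^ 2 := by linarith
  have hlohi : 1 - α ^ 2 < 1 := by linarith
  have := fun k => isProbabilityMeasure_gammaLaw (ha k)
  have := isProbabilityMeasure_unifLaw hlohi
  have := isProbabilityMeasure_unifFin hK
  have hjoint : MeasurePreserving
      (fun ω => ((fun k => S k ω, Y ω, J ω) : (Fin K → ℝ) × ℝ × Fin K)) μ
      ((Measure.pi fun k => gammaLaw (a k)).prod
        ((unifLaw (1 - α ^ 2) 1).prod (unifFin K))) := ⟨by fun_prop, hlaw⟩
  have hmarg : ∀ k, MeasurePreserving (fun ω => ((S k ω, Y ω), J ω)) μ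
      (((gammaLaw (a k)).prod (unifLaw (1 - α ^ 2) 1)).prod (unifFin K)) := fun k =>
    ((measurePreserving_prodAssoc _ _ _).symm _).comp
      (((measurePreserving_eval (fun k => gammaLaw (a k)) k).prod
        (MeasurePreserving.id _)).comp hjoint)
  let f : Fin K → (ℝ × ℝ) × Fin K → ℝ := fun k z =>
    Real.log (1 + z.1.1 * z.1.2) * ({k} : Set (Fin K)).indicator (fun _ => (1 : ℝ)) z.2
  have hf : ∀ k, Integrable (f k)
      (((gammaLaw (a k)).prod (unifLaw (1 - α ^ 2) 1)).prod (unifFin K)) := fun k =>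
    (integrable_log_one_add_mul (ha k) hlo.le hlohi).mul_prod
      ((integrable_const (1 : ℝ)).indicator (measurableSet_singleton k))
  have hsum : ∀ ω, Real.log (1 + S (J ω) ω * Y ω) = ∑ k, f k ((S k ω, Y ω), J ω) := fun ω => by
    simp [f, indicator_apply]
  simp_rw [hsum]
  have hfint : ∀ k, Integrable (fun ω => f k ((S k ω, Y ω), J ω)) μ := fun k =>
    (hmarg k).integrable_comp_of_integrable (hf k)
  rw [integral_finsetSum _ fun k _ => hfint k, Finset.mul_sum]
  refine Finset.sum_congr rfl fun k _ => ?_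
  have hint : ∫ ω, f k ((S k ω, Y ω), J ω) ∂μ = ∫ z, f k z
      ∂((gammaLaw (a k)).prod (unifLaw (1 - α ^ 2) 1)).prod (unifFin K) := by
    rw [← (hmarg k).map_eq, integral_map (hmarg k).measurable.aemeasurable]
    rw [(hmarg k).map_eq]
    exact (hf k).aestronglyMeasurable
  rw [hint, integral_prod_mul (fun z : ℝ × ℝ => Real.log (1 + z.1 * z.2)),
    integral_log_one_add_mul (ha k) hlo hlohi, integral_indicator_singleton_unifFin]
  rw [sub_sub_cancel, div_one]
  ring
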